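/- arXiv:math/0306123 — 4 statements merged into one kernel-verified Lean document; each statement's English description precedes it below -/
import Mathlib

section
/- Let K be a field, V a finite-dimensional K-vector space, and N a nilpotent K-linear endomorphism of V. Then there exists a unique monodromy filtration for N on V, i.e. a unique increasing filtration M : ℤ → {subspaces of V}, monotone, with M_j = 0 for all sufficiently small j and M_j = V for all sufficiently large j, such that N(M_j) ⊆ M_{j-2} for all j ∈ ℤ, and for every j ≥ 0 the endomorphism N^j induces an isomorphism M_j/M_{j-1} ≅ M_{-j}/M_{-j-1}. -/
/-- A *monodromy filtration* for a nilpotent endomorphism `N` of `V`: an increasing,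
exhaustive and separated filtration `M` with `N (M j) ⊆ M (j-2)`, such that for every
`j ≥ 0` the map induced by `N ^ j` from `M j / M (j-1)` to `M (-j) / M (-j-1)` is an
isomorphism (it is well defined, surjective and injective on the graded pieces). -/
def IsMonodromyFiltration {K V : Type*} [Field K] [AddCommGroup V] [Module K V]
    (N : V →ₗ[K] V) (M : ℤ → Submodule K V) : Prop :=
  Monotone M ∧
  (∃ a : ℤ, ∀ j : ℤ, j ≤ a → M j = ⊥) ∧
  (∃ b : ℤ, ∀ j : ℤ, b ≤ j → M j = ⊤) ∧
  (∀ j : ℤ, ∀ v ∈ M j, N v ∈ M (j - 2)) ∧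
  (∀ j : ℕ,
    (∀ v ∈ M (j : ℤ), (N ^ j) v ∈ M (-(j : ℤ))) ∧
    (∀ v ∈ M (-(j : ℤ)), ∃ w ∈ M (j : ℤ), v - (N ^ j) w ∈ M (-(j : ℤ) - 1)) ∧
    (∀ v ∈ M (j : ℤ), (N ^ j) v ∈ M (-(j : ℤ) - 1) → v ∈ M ((j : ℤ) - 1)))

/-- The convolution of the kernel and image filtrations of `N`, whose `k`-th step is
`∑ i, N ^ i (ker N ^ (k + 2 * i + 1))`. -/
def kerImageFiltration {K V : Type*} [Field K] [AddCommGroup V] [Module K V]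
    (N : V →ₗ[K] V) (k : ℤ) : Submodule K V :=
  ⨆ i : ℕ, (LinearMap.ker (N ^ (k + 2 * i + 1).toNat)).map (N ^ i)

namespace kerImageFiltration

variable {K V : Type*} [Field K] [AddCommGroup V] [Module K V] {N : V →ₗ[K] V}

theorem le_iff {k : ℤ} {P : Submodule K V} :
    kerImageFiltration N k ≤ P ↔
      ∀ (i : ℕ) (v : V), (N ^ (k + 2 * i + 1).toNat) v = 0 → (N ^ i) v ∈ P := by
  simp only [kerImageFiltration, iSup_le_iff, Submodule.map_le_iff_le_comap]
  exact Iff.rfl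

theorem pow_apply_mem {k : ℤ} (i : ℕ) {v : V} (hv : (N ^ (k + 2 * i + 1).toNat) v = 0) :
    (N ^ i) v ∈ kerImageFiltration N k :=
  le_iff.1 le_rfl i v hv

theorem mem_of_pow_apply_eq_zero {k : ℤ} {v : V} {m : ℕ} (hm : (m : ℤ) ≤ k + 1)
    (hv : (N ^ m) v = 0) : v ∈ kerImageFiltration N k := by
  simpa using pow_apply_mem (k := k) 0 (Module.End.pow_map_zero_of_le (by omega) hv)

theorem monotone : Monotone (kerImageFiltration N) := fun _ _ h =>
  le_iff.2 fun i _ hv => pow_apply_mem i (Module.End.pow_map_zero_of_le (by omega) hv)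

theorem apply_mem {k : ℤ} {v : V} (hv : v ∈ kerImageFiltration N k) :
    N v ∈ kerImageFiltration N (k - 2) := by
  suffices h : kerImageFiltration N k ≤ (kerImageFiltration N (k - 2)).comap N from h hv
  refine le_iff.2 fun i w hw => ?_
  rw [Submodule.mem_comap, ← Module.End.mul_apply, ← pow_succ']
  exact pow_apply_mem (i + 1) (Module.End.pow_map_zero_of_le (by omega) hw)

/-- `N ^ j` maps step `j` onto step `-j`. -/
theorem exists_pow_apply_eq (j : ℕ) {v : V} (hv : v ∈ kerImageFiltration N (-j)) :
    ∃ w ∈ kerImageFiltration N j, (N ^ j) w = v := by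
  suffices h : kerImageFiltration N (-j) ≤ (kerImageFiltration N j).map (N ^ j) from h hv
  refine le_iff.2 fun i w hw => ?_
  rcases lt_or_ge i j with hij | hij
  · rw [Module.End.pow_map_zero_of_le (by omega) hw]
    exact zero_mem _
  · refine ⟨(N ^ (i - j)) w,
      pow_apply_mem (i - j) (Module.End.pow_map_zero_of_le (by omega) hw), ?_⟩
    rw [← Module.End.mul_apply, ← pow_add, Nat.add_sub_cancel' hij]

end kerImageFiltration

section

variable {K V : Type*} [Field K] [AddCommGroup V] [Module K V] {N : V →ₗ[K] V}

theorem pow_apply_mem_of_apply_mem {M : ℤ → Submodule K V}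
    (hM : ∀ j : ℤ, ∀ v ∈ M j, N v ∈ M (j - 2)) (i : ℕ) {j : ℤ} {v : V} (hv : v ∈ M j) :
    (N ^ i) v ∈ M (j - 2 * i) := by
  induction i with
  | zero => simpa using hv
  | succ i ih =>
    rw [pow_succ', Module.End.mul_apply]
    convert hM _ _ ih using 2
    push_cast
    ring

theorem isMonodromyFiltration_kerImageFiltration (hN : IsNilpotent N) :
    IsMonodromyFiltration N (kerImageFiltration N) := by
  obtain ⟨n, hn⟩ := hN
  have hn' (v : V) : (N ^ n) v = 0 := by simp [hn]
  refine ⟨kerImageFiltration.monotone, ⟨-n, fun j hj => ?_⟩, ⟨n, fun j hj => ?_⟩,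
    fun _ _ => kerImageFiltration.apply_mem, fun j => ⟨fun v hv => ?_, fun v hv => ?_,
    fun v _ hNv => ?_⟩⟩
  · refine eq_bot_iff.2 (kerImageFiltration.le_iff.2 fun i v hv => ?_)
    rw [Submodule.mem_bot]
    rcases le_or_gt n i with h | h
    · exact Module.End.pow_map_zero_of_le h (hn' v)
    · exact Module.End.pow_map_zero_of_le (by omega) hv
  · exact eq_top_iff.2 fun v _ =>
      kerImageFiltration.mem_of_pow_apply_eq_zero (by omega) (hn' v)
  · convert pow_apply_mem_of_apply_mem (M := kerImageFiltration N)
      (fun _ _ => kerImageFiltration.apply_mem) j hv using 2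
    ring
  · obtain ⟨w, hw, rfl⟩ := kerImageFiltration.exists_pow_apply_eq j hv
    exact ⟨w, hw, by simp⟩
  · obtain ⟨w, hw, hwv⟩ := kerImageFiltration.exists_pow_apply_eq (j + 1) (v := (N ^ j) v)
      (by convert hNv using 2; push_cast; ring)
    rw [pow_succ, Module.End.mul_apply] at hwv
    have hNw : N w ∈ kerImageFiltration N ((j : ℤ) - 1) := by
      convert kerImageFiltration.apply_mem hw using 2
      push_cast
      ring
    have hsub : v - N w ∈ kerImageFiltration N ((j : ℤ) - 1) :=
      kerImageFiltration.mem_of_pow_apply_eq_zero (m := j) (by omega) (by simp [hwv])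
    simpa using add_mem hsub hNw

namespace IsMonodromyFiltration

variable {M : ℤ → Submodule K V}

theorem mem_of_pow_succ_apply_eq_zero (hM : IsMonodromyFiltration N M) {p : ℕ} {v : V}
    (hv : (N ^ (p + 1)) v = 0) : v ∈ M p := by
  obtain ⟨-, -, ⟨b, hb⟩, -, hiso⟩ := hM
  have key (d : ℕ) : v ∈ M (p + d) → v ∈ M p := by
    induction d with
    | zero => simp
    | succ d ih =>
      refine fun h => ih ?_
      have := (hiso (p + (d + 1))).2.2 v (by exact_mod_cast h) (by
        rw [Module.End.pow_map_zero_of_le (by omega) hv]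
        exact zero_mem _)
      convert this using 2
      push_cast
      ring
  refine key (b - p).toNat ?_
  rw [hb _ (by omega)]
  exact Submodule.mem_top

theorem exists_pow_apply_eq (hM : IsMonodromyFiltration N M) (j : ℕ) {v : V}
    (hv : v ∈ M (-j)) : ∃ w ∈ M j, (N ^ j) w = v := by
  obtain ⟨hmono, ⟨a, ha⟩, -, hN, hiso⟩ := hM
  have key (d : ℕ) : ∀ j : ℕ, -a ≤ j + d → ∀ v ∈ M (-j), ∃ w ∈ M j, (N ^ j) w = v := by
    induction d with
    | zero =>
      intro j hj v hv
      rw [ha _ (by omega), Submodule.mem_bot] at hv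
      exact ⟨0, zero_mem _, by simp [hv]⟩
    | succ d ih =>
      intro j hj v hv
      obtain ⟨w, hw, hvw⟩ := (hiso j).2.1 v hv
      obtain ⟨u, hu, huv⟩ := ih (j + 1) (by push_cast at hj ⊢; omega) (v - (N ^ j) w)
        (by convert hvw using 2; push_cast; ring)
      rw [pow_succ, Module.End.mul_apply] at huv
      refine ⟨w + N u, add_mem hw (hmono ?_ (hN _ _ hu)), by simp [huv]⟩
      push_cast
      omega
  exact key (-a).toNat j (by omega) v hv

theorem kerImageFiltration_le (hM : IsMonodromyFiltration N M) (k : ℤ) :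
    kerImageFiltration N k ≤ M k := by
  refine kerImageFiltration.le_iff.2 fun i v hv => ?_
  rcases le_or_gt (k + 2 * i + 1) 0 with h | h
  · rw [Int.toNat_of_nonpos h, pow_zero, Module.End.one_apply] at hv
    simp [hv]
  · obtain ⟨p, hp⟩ : ∃ p : ℕ, k + 2 * i = p := ⟨(k + 2 * i).toNat, by omega⟩
    have hvp : v ∈ M p := hM.mem_of_pow_succ_apply_eq_zero (by
      convert hv using 3
      omega)
    convert pow_apply_mem_of_apply_mem hM.2.2.2.1 i hvp using 2
    omega

theorem le_kerImageFiltration_natCast (hM : IsMonodromyFiltration N M)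
    (hN : IsNilpotent N) (j : ℕ) : M j ≤ kerImageFiltration N j := by
  obtain ⟨n, hn⟩ := hN
  have key (d : ℕ) : ∀ j : ℕ, n ≤ j + d → M j ≤ kerImageFiltration N j := by
    induction d with
    | zero =>
      exact fun j hj v _ =>
        kerImageFiltration.mem_of_pow_apply_eq_zero (m := n) (by omega) (by simp [hn])
    | succ d ih =>
      intro j hj v hv
      obtain ⟨w, hw, hwv⟩ := hM.exists_pow_apply_eq (j + 2) (v := (N ^ (j + 1)) v) (by
        convert pow_apply_mem_of_apply_mem hM.2.2.2.1 (j + 1) hv using 2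
        push_cast
        ring)
      rw [pow_succ N (j + 1), Module.End.mul_apply] at hwv
      have hNw : N w ∈ kerImageFiltration N j := by
        convert kerImageFiltration.apply_mem (ih (j + 2) (by omega) hw) using 2
        push_cast
        ring
      have hsub : v - N w ∈ kerImageFiltration N j :=
        kerImageFiltration.mem_of_pow_apply_eq_zero (m := j + 1) (by omega) (by simp [hwv])
      simpa using add_mem hsub hNw
  exact key n j (by omega)

theorem eq_kerImageFiltration (hM : IsMonodromyFiltration N M) (hN : IsNilpotent N) :
    M = kerImageFiltration N := by
  refine funext fun k => le_antisymm ?_ (hM.kerImageFiltration_le k)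
  obtain ⟨j, rfl | rfl⟩ := k.eq_nat_or_neg
  · exact hM.le_kerImageFiltration_natCast hN j
  · intro v hv
    obtain ⟨w, hw, rfl⟩ := hM.exists_pow_apply_eq j hv
    exact ((isMonodromyFiltration_kerImageFiltration hN).2.2.2.2 j).1 w
      (hM.le_kerImageFiltration_natCast hN j hw)

end IsMonodromyFiltration

end


/-- **Existence and uniqueness of the monodromy filtration** (Deligne, Weil II, 1.6.1):
a nilpotent endomorphism of a finite-dimensional vector space admits a unique
monodromy filtration. -/
theorem existsUnique_isMonodromyFiltration
    {K V : Type*} [Field K] [AddCommGroup V] [Module K V] [FiniteDimensional K V]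
    (N : V →ₗ[K] V) (hN : IsNilpotent N) :
    ∃! M : ℤ → Submodule K V, IsMonodromyFiltration N M := by
  exact ⟨kerImageFiltration N, isMonodromyFiltration_kerImageFiltration hN,
    fun _ hM => hM.eq_kerImageFiltration hN⟩
end

section
/- Let K be a field, V a finite-dimensional K-vector space, N a nilpotent K-linear endomorphism of V, and let M : ℤ → {subspaces of V} be a monodromy filtration for N. Then the kernel of N is contained in M_0. -/
theorem IsMonodromyFiltration.ker_inf_le_zero {K V : Type*} [Field K] [AddCommGroup V]
    [Module K V] {N : V →ₗ[K] V} {M : ℤ → Submodule K V} (hM : IsMonodromyFiltration N M)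
    (n : ℕ) : LinearMap.ker N ⊓ M n ≤ M 0 := by
  obtain ⟨-, -, -, -, hiso⟩ := hM
  induction n with
  | zero => exact inf_le_right
  | succ k ih =>
    rintro v ⟨hv, hvM⟩
    have hpow : (N ^ (k + 1)) v = 0 := by
      rw [pow_succ, Module.End.mul_apply, LinearMap.mem_ker.mp hv, map_zero]
    have hvk := (hiso (k + 1)).2.2 v hvM (hpow ▸ zero_mem _)
    exact ih ⟨hv, by simpa using hvk⟩

/-- The kernel of the nilpotent endomorphism `N` is contained in `M 0`, where `M`
is a monodromy filtration for `N`.  (This is the linear-algebra content of the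
assertion `M^I ⊆ M_0` in §4 of Raskind–Xarles.) -/
theorem ker_le_monodromyFiltration_zero
    {K V : Type*} [Field K] [AddCommGroup V] [Module K V] [FiniteDimensional K V]
    (N : V →ₗ[K] V) (hN : IsNilpotent N)
    (M : ℤ → Submodule K V) (hM : IsMonodromyFiltration N M) :
    LinearMap.ker N ≤ M 0 := by
  intro v hv
  obtain ⟨b, hb⟩ := hM.2.2.1
  exact hM.ker_inf_le_zero b.toNat ⟨hv, by rw [hb _ b.self_le_toNat]; trivial⟩
end

section
/- Let k be a field, G a group, V a finite-dimensional k-vector space with a representation ρ : G → GL(V), χ : G → kˣ a group homomorphism, and I a subgroup of G such that for all integers i ≠ j there exists g ∈ I with χ(g)^i ≠ χ(g)^j. Let F and F' be two decreasing filtrations ℤ → {subspaces of V} (antitone), each with F^i = V for all sufficiently small i and F^i = 0 for all sufficiently large i, each with every F^i stable under ρ(g) for all g ∈ G, and each satisfying: for every i ∈ ℤ, every g ∈ I and every v ∈ F^i, one has ρ(g)(v) − χ(g)^i · v ∈ F^{i+1} (i.e. I acts on each graded quotient F^i/F^{i+1} via the character χ^i), and similarly for F'. Then F^i = F'^i for all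 i. -/
section FiltrationComparison

variable {k G V : Type*} [Field k] [Group G] [AddCommGroup V] [Module k V]
  {ρ : Representation k G V} {χ : G →* kˣ} {I : Subgroup G} {F F' : ℤ → Submodule k V}

/-- For `j < i`, the image of `F i ⊓ F' j` in `F' j / F' (j + 1)` vanishes, since the characters
`χ ^ m` with `i ≤ m` are all distinct from `χ ^ j` on `I`. -/
theorem filtration_inf_le_succ
    (hsep : ∀ i j : ℤ, i ≠ j → ∃ g ∈ I, χ g ^ i ≠ χ g ^ j)
    (hFsep : ∃ b : ℤ, ∀ i : ℤ, b ≤ i → F i = ⊥)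
    (hF'stab : ∀ (g : G) (i : ℤ), ∀ v ∈ F' i, ρ g v ∈ F' i)
    (hFgr : ∀ (i : ℤ), ∀ g ∈ I, ∀ v ∈ F i, ρ g v - ((χ g ^ i : kˣ) : k) • v ∈ F (i + 1))
    (hF'gr : ∀ (i : ℤ), ∀ g ∈ I, ∀ v ∈ F' i, ρ g v - ((χ g ^ i : kˣ) : k) • v ∈ F' (i + 1))
    {i j : ℤ} (hij : j < i) : F i ⊓ F' j ≤ F' (j + 1) := by
  obtain ⟨b, hb⟩ := hFsep
  obtain ⟨n, hn⟩ : ∃ n : ℕ, b ≤ i + n := ⟨(b - i).toNat, by lia⟩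
  induction n generalizing i with
  | zero => simp [hb i (by simpa using hn)]
  | succ n ih =>
    rintro v ⟨hv, hv'⟩
    obtain ⟨g, hg, hne⟩ := hsep i j hij.ne'
    have h₁ : ρ g v - ((χ g ^ i : kˣ) : k) • v ∈ F' (j + 1) :=
      ih (i := i + 1) (by lia) (by push_cast at hn; lia)
        ⟨hFgr i g hg v hv, sub_mem (hF'stab g j v hv') ((F' j).smul_mem _ hv')⟩
    have h₂ := sub_mem (hF'gr j g hg v hv') h₁
    rw [sub_sub_sub_cancel_left, ← sub_smul] at h₂
    exact ((F' (j + 1)).smul_mem_iff (sub_ne_zero.mpr (Units.val_injective.ne hne))).mp h₂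

theorem filtration_le
    (hsep : ∀ i j : ℤ, i ≠ j → ∃ g ∈ I, χ g ^ i ≠ χ g ^ j)
    (hF'exh : ∃ a : ℤ, ∀ i : ℤ, i ≤ a → F' i = ⊤)
    (hFsep : ∃ b : ℤ, ∀ i : ℤ, b ≤ i → F i = ⊥)
    (hF'stab : ∀ (g : G) (i : ℤ), ∀ v ∈ F' i, ρ g v ∈ F' i)
    (hFgr : ∀ (i : ℤ), ∀ g ∈ I, ∀ v ∈ F i, ρ g v - ((χ g ^ i : kˣ) : k) • v ∈ F (i + 1))
    (hF'gr : ∀ (i : ℤ), ∀ g ∈ I, ∀ v ∈ F' i, ρ g v - ((χ g ^ i : kˣ) : k) • v ∈ F' (i + 1))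
    (i : ℤ) : F i ≤ F' i := by
  obtain ⟨a, ha⟩ := hF'exh
  have key : ∀ (n : ℕ) (j : ℤ), j ≤ a + n → j ≤ i → F i ≤ F' j := by
    intro n
    induction n with
    | zero => intro j hj _; simp [ha j (by simpa using hj)]
    | succ n ih =>
      intro j hj hji
      have h := filtration_inf_le_succ hsep hFsep hF'stab hFgr hF'gr (i := i) (j := j - 1) (by lia)
      rw [sub_add_cancel] at h
      exact (le_inf le_rfl (ih (j - 1) (by push_cast at hj; lia) (by lia))).trans h
  exact key (i - a).toNat i (by lia) le_rfl

end FiltrationComparison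

/-- **Uniqueness of the ordinary filtration** (§6 of Raskind–Xarles).
Let `ρ : G → GL(V)` be a finite-dimensional representation over a field `k`,
`χ : G → kˣ` a character and `I ≤ G` a subgroup such that the integer powers of `χ`
are pairwise distinct on `I`.  Then there is at most one exhaustive separated
decreasing `G`-stable filtration of `V` on whose `i`-th graded quotient `I` acts
through `χ^i`. -/
theorem ordinary_filtration_unique
    {k G V : Type*} [Field k] [Group G] [AddCommGroup V] [Module k V]
    [FiniteDimensional k V]
    (ρ : Representation k G V) (χ : G →* kˣ) (I : Subgroup G)
    (hsep : ∀ i j : ℤ, i ≠ j → ∃ g ∈ I, χ g ^ i ≠ χ g ^ j)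
    (F F' : ℤ → Submodule k V)
    (hFanti : Antitone F) (hF'anti : Antitone F')
    (hFexh : ∃ a : ℤ, ∀ i : ℤ, i ≤ a → F i = ⊤)
    (hF'exh : ∃ a : ℤ, ∀ i : ℤ, i ≤ a → F' i = ⊤)
    (hFsep : ∃ b : ℤ, ∀ i : ℤ, b ≤ i → F i = ⊥)
    (hF'sep : ∃ b : ℤ, ∀ i : ℤ, b ≤ i → F' i = ⊥)
    (hFstab : ∀ (g : G) (i : ℤ), ∀ v ∈ F i, ρ g v ∈ F i)
    (hF'stab : ∀ (g : G) (i : ℤ), ∀ v ∈ F' i, ρ g v ∈ F' i)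
    -- `I` acts on `F i / F (i+1)` via the character `χ ^ i`
    (hFgr : ∀ (i : ℤ), ∀ g ∈ I, ∀ v ∈ F i, ρ g v - ((χ g ^ i : kˣ) : k) • v ∈ F (i + 1))
    (hF'gr : ∀ (i : ℤ), ∀ g ∈ I, ∀ v ∈ F' i, ρ g v - ((χ g ^ i : kˣ) : k) • v ∈ F' (i + 1)) :
    ∀ i : ℤ, F i = F' i := by
  exact fun i => le_antisymm
    (filtration_le hsep hF'exh hFsep hF'stab hFgr hF'gr i)
    (filtration_le hsep hFexh hF'sep hFstab hF'gr hFgr i)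
end

section
/- Let K be an algebraically closed field, V a finite-dimensional K-vector space, f a K-linear endomorphism of V, and S : ℤ → (sets of elements of K) a family of pairwise disjoint subsets of K (S_i ∩ S_j = ∅ for i ≠ j). Let M and M' be two increasing filtrations ℤ → {subspaces of V}, each monotone, equal to 0 for all sufficiently small indices and to V for all sufficiently large indices, each with every term stable under f, and such that for every i, every eigenvalue of the endomorphism induced by f on the graded quotient M_i/M_{i-1} lies in S_i, and likewise every eigenvalue of the endomorphism induced by f on M'_i/M'_{i-1} lies in S_i. Then M_i = M'_i for all i. -/
/-- The endomorphism induced by `f` on the quotient `p ⧸ q` (i.e. `p / (q ⊓ p)` viewed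
inside `p`), for `f`-stable submodules `q ≤ p` of `V`. -/
def inducedQuotientEnd {K V : Type*} [Field K] [AddCommGroup V] [Module K V]
    (f : V →ₗ[K] V) (p q : Submodule K V)
    (hp : ∀ x ∈ p, f x ∈ p) (hq : ∀ x ∈ q, f x ∈ q) :
    (p ⧸ q.comap p.subtype) →ₗ[K] (p ⧸ q.comap p.subtype) :=
  Submodule.mapQ _ _ (f.restrict hp)
    (fun x hx => by
      rw [Submodule.mem_comap] at hx ⊢
      simpa [LinearMap.restrict_coe_apply] using hq _ hx)

open Polynomial in
/-- If a submodule `N` contains every vector that some `f - μ`, `μ ∈ T`, maps into `N`, then it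
contains every vector that a product of such factors maps into `N`. -/
theorem mem_of_aeval_prod_X_sub_C_mem {K V : Type*} [Field K] [AddCommGroup V] [Module K V]
    {f : V →ₗ[K] V} {T : Set K} {N : Submodule K V}
    (hN : ∀ μ ∈ T, ∀ x, f x - μ • x ∈ N → x ∈ N)
    (s : Multiset K) (hs : ∀ μ ∈ s, μ ∈ T) (x : V)
    (hx : aeval f (s.map fun μ => X - C μ).prod x ∈ N) : x ∈ N := by
  induction s using Multiset.induction_on generalizing x with
  | empty => simpa using hx
  | cons μ s ih =>
    refine ih (fun ν hν => hs ν (Multiset.mem_cons_of_mem hν)) x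
      (hN μ (hs μ (Multiset.mem_cons_self μ s)) _ ?_)
    simpa [Module.algebraMap_end_apply] using hx

open Polynomial in
/-- A linear map intertwining two endomorphisms intertwines every polynomial in them. -/
theorem aeval_apply_of_intertwines {K V W : Type*} [Field K] [AddCommGroup V] [Module K V]
    [AddCommGroup W] [Module K W] {g : V →ₗ[K] V} {f : W →ₗ[K] W} (φ : V →ₗ[K] W)
    (h : ∀ x, f (φ x) = φ (g x)) (P : K[X]) (x : V) :
    aeval f P (φ x) = φ (aeval g P x) := by
  induction P using Polynomial.induction_on generalizing x with
  | C a => simp [Module.algebraMap_end_apply]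
  | add P Q hP hQ => simp [hP, hQ]
  | monomial n a ih =>
    rw [pow_succ, ← mul_assoc, map_mul, map_mul (aeval g), aeval_X, aeval_X,
      Module.End.mul_apply, Module.End.mul_apply, h, ih]

/-- If `μ` is not an eigenvalue on `p / q`, then `f - μ` is injective on `p / q`. -/
theorem mem_of_sub_smul_mem_of_not_hasEigenvalue {K V : Type*} [Field K] [AddCommGroup V]
    [Module K V] (f : V →ₗ[K] V) (p q : Submodule K V)
    (hp : ∀ x ∈ p, f x ∈ p) (hq : ∀ x ∈ q, f x ∈ q) {μ : K}
    (hμ : ¬ Module.End.HasEigenvalue (inducedQuotientEnd f p q hp hq) μ)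
    {x : V} (hx : x ∈ p) (hfx : f x - μ • x ∈ q) : x ∈ q := by
  by_contra hxq
  refine hμ (Module.End.hasEigenvalue_of_hasEigenvector
    (x := Submodule.Quotient.mk ⟨x, hx⟩) ⟨Module.End.mem_eigenspace_iff.2 ?_, ?_⟩)
  · exact (Submodule.Quotient.eq _).2 hfx
  · rw [Ne, Submodule.Quotient.mk_eq_zero]
    exact hxq

/-- If `N` contains `q` and `f - μ` is injective modulo `N` for every eigenvalue `μ` of `f` on
`p / q`, then `N` contains `p`. -/
theorem le_of_hasEigenvalue_inducedQuotientEnd {K V : Type*} [Field K] [IsAlgClosed K]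
    [AddCommGroup V] [Module K V] [FiniteDimensional K V] (f : V →ₗ[K] V) (p q : Submodule K V)
    (hp : ∀ x ∈ p, f x ∈ p) (hq : ∀ x ∈ q, f x ∈ q) {N : Submodule K V} (hqN : q ≤ N)
    (hN : ∀ μ, Module.End.HasEigenvalue (inducedQuotientEnd f p q hp hq) μ →
      ∀ x, f x - μ • x ∈ N → x ∈ N) : p ≤ N := by
  intro x hx
  set g := inducedQuotientEnd f p q hp hq
  have hmonic : (minpoly K g).Monic := minpoly.monic (Algebra.IsIntegral.isIntegral g)
  refine mem_of_aeval_prod_X_sub_C_mem (T := {μ | Module.End.HasEigenvalue g μ}) hN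
    (minpoly K g).roots
    (fun μ hμ => Module.End.hasEigenvalue_of_isRoot (Polynomial.isRoot_of_mem_roots hμ)) x ?_
  rw [← (IsAlgClosed.splits (minpoly K g)).eq_prod_roots_of_monic hmonic]
  have h := aeval_apply_of_intertwines (f := g) (g := f.restrict hp)
    (Submodule.mkQ (q.comap p.subtype)) (fun _ => rfl) (minpoly K g) ⟨x, hx⟩
  have h' := aeval_apply_of_intertwines (f := f) (g := f.restrict hp) p.subtype (fun _ => rfl)
    (minpoly K g) ⟨x, hx⟩
  rw [minpoly.aeval, LinearMap.zero_apply, eq_comm, Submodule.mkQ_apply,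
    Submodule.Quotient.mk_eq_zero, Submodule.mem_comap, ← h'] at h
  exact hqN h

/-- One inclusion in the uniqueness of the weight filtration. -/
theorem weight_filtration_le {K V : Type*} [Field K] [IsAlgClosed K] [AddCommGroup V]
    [Module K V] [FiniteDimensional K V] (f : V →ₗ[K] V) (S : ℤ → Set K)
    (hS : ∀ i j : ℤ, i ≠ j → Disjoint (S i) (S j)) (M M' : ℤ → Submodule K V)
    (hMbot : ∃ a : ℤ, ∀ i : ℤ, i ≤ a → M i = ⊥) (hM'top : ∃ b : ℤ, ∀ i : ℤ, b ≤ i → M' i = ⊤)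
    (hMstab : ∀ i : ℤ, ∀ x ∈ M i, f x ∈ M i) (hM'stab : ∀ i : ℤ, ∀ x ∈ M' i, f x ∈ M' i)
    (hM'mono : Monotone M')
    (hMeig : ∀ i : ℤ, ∀ μ : K,
      Module.End.HasEigenvalue
        (inducedQuotientEnd f (M i) (M (i - 1)) (hMstab i) (hMstab (i - 1))) μ → μ ∈ S i)
    (hM'eig : ∀ i : ℤ, ∀ μ : K,
      Module.End.HasEigenvalue
        (inducedQuotientEnd f (M' i) (M' (i - 1)) (hM'stab i) (hM'stab (i - 1))) μ → μ ∈ S i)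
    (i : ℤ) : M i ≤ M' i := by
  obtain ⟨a, ha⟩ := hMbot
  obtain ⟨b, hb⟩ := hM'top
  have hinj : ∀ j ≤ i, ∀ μ ∈ S j, ∀ x, f x - μ • x ∈ M' i → x ∈ M' i := by
    intro j hj μ hμ x hx
    have hdescend : ∀ k, i ≤ k → x ∈ M' k → x ∈ M' i := by
      intro k hk
      induction k, hk using Int.leInduction with
      | base => exact id
      | succ k hk ih =>
        intro hxk
        have hnot : ¬ Module.End.HasEigenvalue (inducedQuotientEnd f (M' (k + 1))
            (M' (k + 1 - 1)) (hM'stab (k + 1)) (hM'stab (k + 1 - 1))) μ := fun h =>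
          Set.disjoint_left.1 (hS j (k + 1) (by omega)) hμ (hM'eig _ _ h)
        have := mem_of_sub_smul_mem_of_not_hasEigenvalue f _ _ _ _ hnot hxk
          (hM'mono (by omega) hx)
        rw [add_sub_cancel_right] at this
        exact ih this
    refine hdescend (max i b) (le_max_left i b) ?_
    rw [hb _ (le_max_right i b)]
    exact Submodule.mem_top
  have hascend : ∀ j, min a i ≤ j → j ≤ i → M j ≤ M' i := by
    intro j hj
    induction j, hj using Int.leInduction with
    | base => intro _; simp [ha _ (min_le_left a i)]
    | succ j hj ih =>
      intro hji
      refine le_of_hasEigenvalue_inducedQuotientEnd f (M (j + 1)) (M (j + 1 - 1))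
        (hMstab _) (hMstab _) ?_ fun μ hμ => hinj (j + 1) hji μ (hMeig _ _ hμ)
      rw [add_sub_cancel_right]
      exact ih (by omega)
  exact hascend i (min_le_right a i) le_rfl

/-- Abstract uniqueness of the weight filtration (Deligne, Weil II, 1.7.5, as used in §4
of Raskind–Xarles): an increasing exhaustive `f`-stable filtration of a finite-dimensional
vector space over an algebraically closed field whose `i`-th graded quotient has all
eigenvalues of the induced endomorphism in prescribed pairwise disjoint sets `S i`
is unique. -/
theorem weight_filtration_unique
    {K V : Type*} [Field K] [IsAlgClosed K] [AddCommGroup V] [Module K V]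
    [FiniteDimensional K V]
    (f : V →ₗ[K] V) (S : ℤ → Set K)
    (hS : ∀ i j : ℤ, i ≠ j → Disjoint (S i) (S j))
    (M M' : ℤ → Submodule K V)
    (hMmono : Monotone M) (hM'mono : Monotone M')
    (hMbot : ∃ a : ℤ, ∀ i : ℤ, i ≤ a → M i = ⊥) (hM'bot : ∃ a : ℤ, ∀ i : ℤ, i ≤ a → M' i = ⊥)
    (hMtop : ∃ b : ℤ, ∀ i : ℤ, b ≤ i → M i = ⊤) (hM'top : ∃ b : ℤ, ∀ i : ℤ, b ≤ i → M' i = ⊤)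
    (hMstab : ∀ i : ℤ, ∀ x ∈ M i, f x ∈ M i) (hM'stab : ∀ i : ℤ, ∀ x ∈ M' i, f x ∈ M' i)
    -- every eigenvalue of the endomorphism induced by `f` on `M i ⧸ M (i-1)` lies in `S i`
    (hMeig : ∀ i : ℤ, ∀ μ : K,
      Module.End.HasEigenvalue
        (inducedQuotientEnd f (M i) (M (i - 1)) (hMstab i) (hMstab (i - 1))) μ → μ ∈ S i)
    (hM'eig : ∀ i : ℤ, ∀ μ : K,
      Module.End.HasEigenvalue
        (inducedQuotientEnd f (M' i) (M' (i - 1)) (hM'stab i) (hM'stab (i - 1))) μ → μ ∈ S i) :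
    ∀ i : ℤ, M i = M' i := by
  exact fun i => le_antisymm
    (weight_filtration_le f S hS M M' hMbot hM'top hMstab hM'stab hM'mono hMeig hM'eig i)
    (weight_filtration_le f S hS M' M hM'bot hMtop hM'stab hMstab hMmono hM'eig hMeig i)
end
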